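/- Assume there is t_max ∈ ℕ with t_max ≥ 1 such that t_s ≤ E[τ|cog,a] ≤ t_max for every cog ∈ C and a ∈ A(cog). Then for every horizon n ≥ 0, every cog ∈ C, every q ∈ ℤ and every Δ ∈ ℕ: V_n(q,cog) − V_n(q+Δ,cog) ≥ ( c·t_s·(1−γ^{n·t_max})/(1−γ^{t_max}) + C₀·γ^{n·t_max} )·Δ ≥ 0; in particular, for each fixed cog and n, the map q ↦ V_n(q,cog) is nonincreasing. -/

import Mathlib

open scoped BigOperators

namespace Fidelity

/-- The actions available to the human operator: skip, rest, normal fidelity, high fidelity. -/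
inductive Action : Type
  | S | R | N | H
deriving DecidableEq

/-- Admissible action set: `{S, N, H}` for `cog ≤ cog*` and `{S, R, N, H}` for `cog > cog*`. -/
def Act {C : Type*} [LinearOrder C] (cogStar cog : C) : Finset Action :=
  if cog ≤ cogStar then {Action.S, Action.N, Action.H}
  else {Action.S, Action.R, Action.N, Action.H}

lemma Act_nonempty {C : Type*} [LinearOrder C] (cogStar cog : C) :
    (Act cogStar cog).Nonempty := by
  unfold Act; split <;> exact ⟨Action.S, by simp⟩

/-- The reward `r(a)`: `r(H) = r_H`, `r(N) = r_N`, `r(S) = r(R) = 0`. -/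
noncomputable def rew (rH rN : ℝ) : Action → ℝ
  | Action.H => rH
  | Action.N => rN
  | _ => 0

/-- Expected net immediate reward
`R((q,cog),a) = r(a) − c·E[τ|cog,a]·q − (cλ/2)·E[τ²|cog,a]`. -/
noncomputable def Rimm {C : Type*} (c lam rH rN : ℝ) (Etau Etau2 : C → Action → ℝ)
    (q : ℤ) (cog : C) (a : Action) : ℝ :=
  rew rH rN a - c * Etau cog a * (q : ℝ) - c * lam / 2 * Etau2 cog a

/-- The Poisson probability of `w` arrivals when the mean number of arrivals is `μ`. -/
noncomputable def poissonPMF (μ : ℝ) (w : ℕ) : ℝ :=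
  Real.exp (-μ) * μ ^ w / (w.factorial : ℝ)

/-- The next queue length: `q − 1 + w` under actions `S, N, H` and `q + w` under `R`. -/
def nextQ (a : Action) (q : ℤ) (w : ℕ) : ℤ :=
  if a = Action.R then q + (w : ℤ) else q - 1 + (w : ℤ)

/-- `E[γ^τ | cog, a]`, the expected discount over a sojourn in state `cog` under action `a`. -/
noncomputable def Egamma {C : Type*} [Fintype C] (γ : ℝ) (P : C → Action → ℕ → C → ℝ)
    (cog : C) (a : Action) : ℝ :=
  ∑' (τ : ℕ), ∑' (cog' : C), γ ^ τ * P cog a τ cog'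

/-- The Q-value of action `a` at `(q, cog)` for the continuation value function `V`:
`Q_V(q,cog,a) = R((q,cog),a) + Σ_{τ,cog',w} γ^τ·P(τ,cog'|cog,a)·Poisson(λτ)(w)·V(q',cog')`. -/
noncomputable def Qval {C : Type*} [Fintype C] (c lam rH rN γ : ℝ)
    (Etau Etau2 : C → Action → ℝ) (P : C → Action → ℕ → C → ℝ)
    (V : ℤ → C → ℝ) (q : ℤ) (cog : C) (a : Action) : ℝ :=
  Rimm c lam rH rN Etau Etau2 q cog a +
    ∑' (τ : ℕ), ∑' (cog' : C), ∑' (w : ℕ),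
      γ ^ τ * P cog a τ cog' * poissonPMF (lam * (τ : ℝ)) w * V (nextQ a q w) cog'

/-- The `n`-step optimal value functions: `V_0(q,cog) = −C₀·q` and
`V_{n+1}(q,cog) = max_{a ∈ A(cog)} Q_{V_n}(q,cog,a)`. -/
noncomputable def Vn {C : Type*} [LinearOrder C] [Fintype C] (cogStar : C)
    (c lam rH rN γ C0 : ℝ) (Etau Etau2 : C → Action → ℝ)
    (P : C → Action → ℕ → C → ℝ) : ℕ → ℤ → C → ℝ
  | 0, q, _ => -C0 * (q : ℝ)
  | n + 1, q, cog =>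
      (Act cogStar cog).sup' (Act_nonempty cogStar cog) fun a =>
        Qval c lam rH rN γ Etau Etau2 P
          (Vn cogStar c lam rH rN γ C0 Etau Etau2 P n) q cog a

lemma poissonPMF_nonneg {μ : ℝ} (hμ : 0 ≤ μ) (w : ℕ) : 0 ≤ poissonPMF μ w := by
  unfold poissonPMF; positivity

lemma hasSum_poissonPMF (μ : ℝ) : HasSum (poissonPMF μ) 1 := by
  have h := (NormedSpace.expSeries_div_hasSum_exp (𝔸 := ℝ) μ).mul_left (Real.exp (-μ))
  rw [← Real.exp_eq_exp_ℝ, ← Real.exp_add, neg_add_cancel, Real.exp_zero] at h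
  refine h.congr_fun fun w => ?_
  simp only [poissonPMF, mul_div_assoc]

lemma hasSum_poissonPMF_mul_id (μ : ℝ) : HasSum (fun w : ℕ => poissonPMF μ w * w) μ := by
  have h : HasSum (fun w : ℕ => poissonPMF μ (w + 1) * ((w + 1 : ℕ) : ℝ)) μ := by
    have h1 := (hasSum_poissonPMF μ).mul_left μ
    rw [mul_one] at h1
    refine h1.congr_fun fun w => ?_
    have : (w.factorial : ℝ) ≠ 0 := by positivity
    simp only [poissonPMF, Nat.factorial_succ, Nat.cast_mul, Nat.cast_add, Nat.cast_one]
    field_simp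
    ring
  simpa using (hasSum_nat_add_iff (f := fun w : ℕ => poissonPMF μ w * w) 1).1 h

/-- `V` has at most linear growth in the queue length, with constant `K`. -/
def LinGrowth {C : Type*} (K : ℝ) (V : ℤ → C → ℝ) : Prop :=
  ∀ q cog, |V q cog| ≤ K * (1 + |(q : ℝ)|)

lemma abs_nextQ_le (a : Action) (q : ℤ) (w : ℕ) :
    |((nextQ a q w : ℤ) : ℝ)| ≤ |(q : ℝ)| + 1 + w := by
  have hw : (0 : ℝ) ≤ w := w.cast_nonneg
  have h1 := le_abs_self (q : ℝ)
  have h2 := neg_abs_le (q : ℝ)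
  rw [abs_le]
  unfold nextQ
  split <;> push_cast <;> constructor <;> linarith

lemma nextQ_add (a : Action) (q d : ℤ) (w : ℕ) : nextQ a (q + d) w = nextQ a q w + d := by
  unfold nextQ
  split <;> ring

section Arrivals

variable {C : Type*} {K μ : ℝ} {V : ℤ → C → ℝ}

lemma hasSum_growth_bound (K μ : ℝ) (q : ℤ) :
    HasSum (fun w : ℕ => poissonPMF μ w * (K * (2 + |(q : ℝ)| + w)))
      (K * (2 + |(q : ℝ)| + μ)) := by
  have h := ((hasSum_poissonPMF μ).mul_left (K * (2 + |(q : ℝ)|))).add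
    ((hasSum_poissonPMF_mul_id μ).mul_left K)
  rw [mul_one, ← mul_add] at h
  refine h.congr_fun fun w => ?_
  ring

lemma abs_poissonPMF_mul_le (hμ : 0 ≤ μ) (hK : 0 ≤ K) (hV : LinGrowth K V)
    (a : Action) (q : ℤ) (cog : C) (w : ℕ) :
    |poissonPMF μ w * V (nextQ a q w) cog| ≤ poissonPMF μ w * (K * (2 + |(q : ℝ)| + w)) := by
  rw [abs_mul, abs_of_nonneg (poissonPMF_nonneg hμ w)]
  refine mul_le_mul_of_nonneg_left ((hV _ _).trans ?_) (poissonPMF_nonneg hμ w)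
  exact mul_le_mul_of_nonneg_left (by linarith [abs_nextQ_le a q w]) hK

lemma summable_poissonPMF_mul (hμ : 0 ≤ μ) (hK : 0 ≤ K) (hV : LinGrowth K V)
    (a : Action) (q : ℤ) (cog : C) :
    Summable fun w : ℕ => poissonPMF μ w * V (nextQ a q w) cog :=
  Summable.of_norm_bounded (hasSum_growth_bound K μ q).summable
    fun w => abs_poissonPMF_mul_le hμ hK hV a q cog w

/-- Expected continuation value over a Poisson number of arrivals with mean `μ`. -/
noncomputable def arrivalMean (V : ℤ → C → ℝ) (μ : ℝ) (a : Action) (q : ℤ) (cog : C) : ℝ :=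
  ∑' w : ℕ, poissonPMF μ w * V (nextQ a q w) cog

lemma abs_arrivalMean_le (hμ : 0 ≤ μ) (hK : 0 ≤ K) (hV : LinGrowth K V)
    (a : Action) (q : ℤ) (cog : C) :
    |arrivalMean V μ a q cog| ≤ K * (2 + μ) * (1 + |(q : ℝ)|) := by
  have h : |arrivalMean V μ a q cog| ≤ K * (2 + |(q : ℝ)| + μ) := by
    rw [← Real.norm_eq_abs]
    exact tsum_of_norm_bounded (hasSum_growth_bound K μ q)
      fun w => abs_poissonPMF_mul_le hμ hK hV a q cog w
  refine h.trans ?_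
  rw [mul_assoc]
  refine mul_le_mul_of_nonneg_left ?_ hK
  nlinarith [abs_nonneg (q : ℝ), mul_nonneg hμ (abs_nonneg (q : ℝ))]

lemma le_arrivalMean_sub (hμ : 0 ≤ μ) (hK : 0 ≤ K) (hV : LinGrowth K V) {M : ℝ} {d : ℤ}
    (hM : ∀ q cog, M ≤ V q cog - V (q + d) cog) (a : Action) (q : ℤ) (cog : C) :
    M ≤ arrivalMean V μ a q cog - arrivalMean V μ a (q + d) cog := by
  have h1 := (summable_poissonPMF_mul hμ hK hV a q cog).hasSum.sub
    (summable_poissonPMF_mul hμ hK hV a (q + d) cog).hasSum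
  have h2 := (hasSum_poissonPMF μ).mul_right M
  rw [one_mul] at h2
  refine hasSum_le (fun w => ?_) h2 h1
  rw [← mul_sub, nextQ_add]
  exact mul_le_mul_of_nonneg_left (hM _ _) (poissonPMF_nonneg hμ w)

end Arrivals

section Sojourn

variable {C : Type*} [Fintype C]

lemma Qval_eq (c lam rH rN γ : ℝ) (Etau Etau2 : C → Action → ℝ) (P : C → Action → ℕ → C → ℝ)
    (V : ℤ → C → ℝ) (q : ℤ) (cog : C) (a : Action) :
    Qval c lam rH rN γ Etau Etau2 P V q cog a =
      Rimm c lam rH rN Etau Etau2 q cog a +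
        ∑' τ : ℕ, ∑ cog', γ ^ τ * P cog a τ cog' * arrivalMean V (lam * τ) a q cog' := by
  simp only [Qval, arrivalMean, tsum_fintype, mul_assoc, tsum_mul_left]

variable {lam γ K : ℝ} {p : ℕ → C → ℝ} {V : ℤ → C → ℝ}

lemma summable_mul_sojourn (hp : ∀ τ cog', 0 ≤ p τ cog')
    (h2 : Summable fun τ : ℕ => (τ : ℝ) ^ 2 * ∑ cog', p τ cog') :
    Summable fun τ : ℕ => (τ : ℝ) * ∑ cog', p τ cog' := by
  have hs : ∀ τ, 0 ≤ ∑ cog', p τ cog' := fun τ => Finset.sum_nonneg fun _ _ => hp _ _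
  refine Summable.of_nonneg_of_le (fun τ => mul_nonneg τ.cast_nonneg (hs τ)) (fun τ => ?_) h2
  refine mul_le_mul_of_nonneg_right ?_ (hs τ)
  exact_mod_cast Nat.le_self_pow two_ne_zero τ

lemma summable_sojourn (hp : ∀ τ cog', 0 ≤ p τ cog') (hp0 : ∀ cog', p 0 cog' = 0)
    (h2 : Summable fun τ : ℕ => (τ : ℝ) ^ 2 * ∑ cog', p τ cog') :
    Summable fun τ : ℕ => ∑ cog', p τ cog' := by
  have hs : ∀ τ, 0 ≤ ∑ cog', p τ cog' := fun τ => Finset.sum_nonneg fun _ _ => hp _ _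
  refine Summable.of_nonneg_of_le hs (fun τ => ?_) h2
  rcases Nat.eq_zero_or_pos τ with rfl | h
  · simp [hp0]
  · refine le_mul_of_one_le_left (hs τ) (one_le_pow₀ ?_)
    exact_mod_cast h

lemma abs_sojourn_term_le (hlam : 0 ≤ lam) (hγ0 : 0 ≤ γ) (hγ1 : γ ≤ 1)
    (hp : ∀ τ cog', 0 ≤ p τ cog') (hK : 0 ≤ K) (hV : LinGrowth K V)
    (a : Action) (q : ℤ) (τ : ℕ) :
    |∑ cog', γ ^ τ * p τ cog' * arrivalMean V (lam * τ) a q cog'| ≤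
      (∑ cog', p τ cog') * (K * (2 + lam * τ)) * (1 + |(q : ℝ)|) := by
  rw [mul_assoc, Finset.sum_mul]
  refine (Finset.abs_sum_le_sum_abs _ _).trans (Finset.sum_le_sum fun cog' _ => ?_)
  rw [abs_mul, abs_of_nonneg (mul_nonneg (pow_nonneg hγ0 τ) (hp τ cog'))]
  exact mul_le_mul (mul_le_of_le_one_left (hp _ _) (pow_le_one₀ hγ0 hγ1))
    (abs_arrivalMean_le (by positivity) hK hV a q cog') (abs_nonneg _) (hp _ _)

lemma summable_growth_sojourn (lam K : ℝ) (hp : ∀ τ cog', 0 ≤ p τ cog')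
    (hp0 : ∀ cog', p 0 cog' = 0)
    (h2 : Summable fun τ : ℕ => (τ : ℝ) ^ 2 * ∑ cog', p τ cog') :
    Summable fun τ : ℕ => (∑ cog', p τ cog') * (K * (2 + lam * τ)) := by
  refine (summable_congr fun τ => ?_).2 (((summable_sojourn hp hp0 h2).mul_left (K * 2)).add
    ((summable_mul_sojourn hp h2).mul_left (K * lam)))
  ring

/-- Jensen's inequality for the discount factor, from the tangent line of `t ↦ γ ^ t`. -/
lemma pow_le_tsum_pow_mul {γ : ℝ} (hγ0 : 0 < γ) (hγ1 : γ ≤ 1) {s : ℕ → ℝ} (hs : ∀ τ, 0 ≤ s τ)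
    (hs1 : HasSum s 1) (hm : Summable fun τ : ℕ => (τ : ℝ) * s τ) {t : ℕ}
    (ht : ∑' τ : ℕ, (τ : ℝ) * s τ ≤ t) :
    γ ^ t ≤ ∑' τ : ℕ, γ ^ τ * s τ := by
  have hsum : Summable fun τ : ℕ => γ ^ τ * s τ :=
    Summable.of_nonneg_of_le (fun τ => mul_nonneg (pow_nonneg hγ0.le τ) (hs τ))
      (fun τ => mul_le_of_le_one_left (hs τ) (pow_le_one₀ hγ0.le hγ1)) hs1.summable
  have hlog : Real.log γ ≤ 0 := Real.log_nonpos hγ0.le hγ1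
  have htan := ((hs1.mul_left (γ ^ t * (1 - Real.log γ * t))).add
    (hm.hasSum.mul_left (γ ^ t * Real.log γ)))
  have hle := hasSum_le (fun τ => ?_) htan hsum.hasSum
  · refine le_trans ?_ hle
    have := mul_nonneg (pow_nonneg hγ0.le t)
      (mul_nonneg_of_nonpos_of_nonpos hlog (sub_nonpos.2 ht))
    linarith
  · have hexp : ∀ k : ℕ, γ ^ k = Real.exp (Real.log γ * k) := fun k => by
      rw [mul_comm, Real.exp_nat_mul, Real.exp_log hγ0]
    have h : γ ^ t * (1 + Real.log γ * (τ - t)) ≤ γ ^ τ := by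
      have h1 := Real.add_one_le_exp (Real.log γ * (τ - t))
      calc γ ^ t * (1 + Real.log γ * (τ - t))
          ≤ γ ^ t * Real.exp (Real.log γ * (τ - t)) :=
            mul_le_mul_of_nonneg_left (by linarith) (pow_nonneg hγ0.le t)
        _ = γ ^ τ := by rw [hexp, hexp, ← Real.exp_add]; ring_nf
    have := mul_le_mul_of_nonneg_right h (hs τ)
    linarith

lemma exists_growth_Qval {c rH rN : ℝ} {Etau Etau2 : C → Action → ℝ}
    {P : C → Action → ℕ → C → ℝ} (hlam : 0 ≤ lam) (hγ0 : 0 ≤ γ) (hγ1 : γ ≤ 1)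
    (hK : 0 ≤ K) (hV : LinGrowth K V) (cog : C) (a : Action)
    (hp : ∀ τ cog', 0 ≤ P cog a τ cog') (hp0 : ∀ cog', P cog a 0 cog' = 0)
    (h2 : Summable fun τ : ℕ => (τ : ℝ) ^ 2 * ∑ cog', P cog a τ cog') :
    ∃ L, 0 ≤ L ∧ ∀ q : ℤ,
      |Qval c lam rH rN γ Etau Etau2 P V q cog a| ≤ L * (1 + |(q : ℝ)|) := by
  have hB := (summable_growth_sojourn lam K hp hp0 h2).hasSum
  set B := ∑' τ : ℕ, (∑ cog', P cog a τ cog') * (K * (2 + lam * τ))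
  have hB0 : 0 ≤ B := tsum_nonneg fun τ =>
    mul_nonneg (Finset.sum_nonneg fun _ _ => hp _ _) (by positivity)
  refine ⟨|rew rH rN a| + |c * Etau cog a| + |c * lam / 2 * Etau2 cog a| + B, by positivity,
    fun q => ?_⟩
  have hT : |∑' τ : ℕ, ∑ cog', γ ^ τ * P cog a τ cog' * arrivalMean V (lam * τ) a q cog'| ≤
      B * (1 + |(q : ℝ)|) := by
    rw [← Real.norm_eq_abs]
    exact tsum_of_norm_bounded (hB.mul_right _)
      fun τ => abs_sojourn_term_le hlam hγ0 hγ1 hp hK hV a q τ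
  have hR : |Rimm c lam rH rN Etau Etau2 q cog a| ≤
      |rew rH rN a| + |c * Etau cog a| * |(q : ℝ)| + |c * lam / 2 * Etau2 cog a| := by
    unfold Rimm
    rw [← abs_mul]
    exact (abs_sub _ _).trans (add_le_add_left (abs_sub _ _) _)
  rw [Qval_eq]
  refine (abs_add_le _ _).trans ((add_le_add hR hT).trans ?_)
  nlinarith [abs_nonneg (q : ℝ), mul_nonneg (abs_nonneg (rew rH rN a)) (abs_nonneg (q : ℝ)),
    mul_nonneg (abs_nonneg (c * lam / 2 * Etau2 cog a)) (abs_nonneg (q : ℝ)),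
    abs_nonneg (c * Etau cog a)]

lemma le_Qval_sub {c rH rN : ℝ} {Etau Etau2 : C → Action → ℝ}
    {P : C → Action → ℕ → C → ℝ} (hlam : 0 ≤ lam) (hγ0 : 0 < γ) (hγ1 : γ ≤ 1)
    (hK : 0 ≤ K) (hV : LinGrowth K V) (cog : C) (a : Action)
    (hp : ∀ τ cog', 0 ≤ P cog a τ cog') (hp0 : ∀ cog', P cog a 0 cog' = 0)
    (h1 : ∑' τ : ℕ, ∑ cog', P cog a τ cog' = 1)
    (h2 : Summable fun τ : ℕ => (τ : ℝ) ^ 2 * ∑ cog', P cog a τ cog') {t : ℕ}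
    (ht : ∑' τ : ℕ, (τ : ℝ) * ∑ cog', P cog a τ cog' ≤ t)
    {M : ℝ} (hM0 : 0 ≤ M) {d : ℤ} (hM : ∀ q cog, M ≤ V q cog - V (q + d) cog) (q : ℤ) :
    c * Etau cog a * d + γ ^ t * M ≤
      Qval c lam rH rN γ Etau Etau2 P V q cog a -
        Qval c lam rH rN γ Etau Etau2 P V (q + d) cog a := by
  have hs : ∀ τ, 0 ≤ ∑ cog', P cog a τ cog' := fun τ => Finset.sum_nonneg fun _ _ => hp _ _
  have hsum := summable_sojourn hp hp0 h2
  have hT : ∀ q : ℤ, Summable fun τ : ℕ =>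
      ∑ cog', γ ^ τ * P cog a τ cog' * arrivalMean V (lam * τ) a q cog' := fun q =>
    Summable.of_norm_bounded ((summable_growth_sojourn lam K hp hp0 h2).mul_right _)
      fun τ => abs_sojourn_term_le hlam hγ0.le hγ1 hp hK hV a q τ
  have hd : Summable fun τ : ℕ => γ ^ τ * ∑ cog', P cog a τ cog' :=
    Summable.of_nonneg_of_le (fun τ => mul_nonneg (pow_nonneg hγ0.le τ) (hs τ))
      (fun τ => mul_le_of_le_one_left (hs τ) (pow_le_one₀ hγ0.le hγ1)) hsum
  have hJ := pow_le_tsum_pow_mul hγ0 hγ1 hs (h1 ▸ hsum.hasSum) (summable_mul_sojourn hp h2) ht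
  have hle := hasSum_le (fun τ => ?_) (hd.hasSum.mul_right M)
    ((hT q).hasSum.sub (hT (q + d)).hasSum)
  · have := mul_le_mul_of_nonneg_right hJ hM0
    rw [Qval_eq, Qval_eq]
    unfold Rimm
    push_cast
    linarith
  · rw [← Finset.sum_sub_distrib, Finset.mul_sum, Finset.sum_mul]
    refine Finset.sum_le_sum fun cog' _ => ?_
    rw [← mul_sub]
    exact mul_le_mul_of_nonneg_left (le_arrivalMean_sub (by positivity) hK hV hM a q cog')
      (mul_nonneg (pow_nonneg hγ0.le τ) (hp τ cog'))

end Sojourn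

lemma exists_linGrowth_Vn {C : Type*} [LinearOrder C] [Fintype C] (cogStar : C)
    {c lam rH rN γ C0 : ℝ} {Etau Etau2 : C → Action → ℝ} {P : C → Action → ℕ → C → ℝ}
    (hlam : 0 ≤ lam) (hγ0 : 0 ≤ γ) (hγ1 : γ ≤ 1)
    (hp : ∀ cog a τ cog', 0 ≤ P cog a τ cog') (hp0 : ∀ cog a cog', P cog a 0 cog' = 0)
    (h2 : ∀ cog a, Summable fun τ : ℕ => (τ : ℝ) ^ 2 * ∑ cog', P cog a τ cog') (n : ℕ) :
    ∃ K, 0 ≤ K ∧ LinGrowth K (Vn cogStar c lam rH rN γ C0 Etau Etau2 P n) := by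
  induction n with
  | zero =>
    refine ⟨|C0|, abs_nonneg _, fun q cog => ?_⟩
    simp only [Vn, abs_mul, abs_neg]
    exact mul_le_mul_of_nonneg_left (by linarith) (abs_nonneg _)
  | succ n ih =>
    obtain ⟨K, hK, hV⟩ := ih
    choose L hL0 hL using fun cog a => exists_growth_Qval (c := c) (rH := rH) (rN := rN)
      (Etau := Etau) (Etau2 := Etau2) hlam hγ0 hγ1 hK hV cog a (hp cog a) (hp0 cog a) (h2 cog a)
    refine ⟨∑ cog, ∑ a ∈ Act cogStar cog, L cog a,
      Finset.sum_nonneg fun _ _ => Finset.sum_nonneg fun _ _ => hL0 _ _, fun q cog => ?_⟩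
    obtain ⟨a, ha, hmax⟩ := Finset.exists_mem_eq_sup' (Act_nonempty cogStar cog) fun a =>
      Qval c lam rH rN γ Etau Etau2 P (Vn cogStar c lam rH rN γ C0 Etau Etau2 P n) q cog a
    rw [Vn, hmax]
    refine (hL cog a q).trans (mul_le_mul_of_nonneg_right ?_ (by positivity))
    exact (Finset.single_le_sum (f := L cog) (fun b _ => hL0 cog b) ha).trans
      (Finset.single_le_sum (f := fun cog => ∑ a ∈ Act cogStar cog, L cog a)
        (fun b _ => Finset.sum_nonneg fun _ _ => hL0 _ _) (Finset.mem_univ cog))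

/-- lower value-difference bound: if `t_s ≤ E[τ|cog,a] ≤ t_max` for all
admissible pairs, then for all `n`, `cog`, `q`, `Δ`:
`V_n(q,cog) − V_n(q+Δ,cog) ≥ (c·t_s·(1−γ^{n·t_max})/(1−γ^{t_max}) + C₀·γ^{n·t_max})·Δ ≥ 0`;
in particular `q ↦ V_n(q,cog)` is nonincreasing. -/
theorem stmt7 {C : Type*} [LinearOrder C] [Fintype C]
    (cogStar : C) (c lam rH rN γ : ℝ) (ts : ℕ)
    (Etau Etau2 : C → Action → ℝ) (P : C → Action → ℕ → C → ℝ)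
    (hc : 0 < c) (hlam : 0 < lam) (hγ : γ ∈ Set.Ioo (0 : ℝ) 1)
    (hrN : 0 ≤ rN) (hrHN : rN < rH) (hts : 1 ≤ ts)
    (hPnn : ∀ cog a τ cog', 0 ≤ P cog a τ cog')
    (hP0 : ∀ cog a cog', P cog a 0 cog' = 0)
    (hPsum : ∀ cog, ∀ a ∈ Act cogStar cog, (∑' (τ : ℕ), ∑' (cog' : C), P cog a τ cog') = 1)
    (hPS : ∀ cog τ cog', τ ≠ ts → P cog Action.S τ cog' = 0)
    (hEtau : ∀ cog a, Etau cog a = ∑' (τ : ℕ), ∑' (cog' : C), (τ : ℝ) * P cog a τ cog')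
    (hEtau2 : ∀ cog a, Etau2 cog a = ∑' (τ : ℕ), ∑' (cog' : C), (τ : ℝ) ^ 2 * P cog a τ cog')
    (hMom2 : ∀ cog a, Summable fun τ : ℕ => (τ : ℝ) ^ 2 * ∑' (cog' : C), P cog a τ cog')
    (tmax : ℕ) (htmax : 1 ≤ tmax) (ρ : ℝ) (hρ : ρ ∈ Set.Ioo (0 : ℝ) 1)
    (hEle : ∀ cog, ∀ a ∈ Act cogStar cog, Etau cog a ≤ (tmax : ℝ))
    (hEts : ∀ cog, ∀ a ∈ Act cogStar cog, (ts : ℝ) ≤ Etau cog a)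
    (C0 : ℝ) (hC0 : 0 ≤ C0) :
    (∀ (n : ℕ) (cog : C) (q : ℤ) (Δ : ℕ),
      (c * (ts : ℝ) * (1 - γ ^ (n * tmax)) / (1 - γ ^ tmax) + C0 * γ ^ (n * tmax)) * (Δ : ℝ)
          ≤ Vn cogStar c lam rH rN γ C0 Etau Etau2 P n q cog
            - Vn cogStar c lam rH rN γ C0 Etau Etau2 P n (q + (Δ : ℤ)) cog ∧
        0 ≤ (c * (ts : ℝ) * (1 - γ ^ (n * tmax)) / (1 - γ ^ tmax) + C0 * γ ^ (n * tmax)) * (Δ : ℝ)) ∧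
    ∀ (n : ℕ) (cog : C), Antitone fun q : ℤ => Vn cogStar c lam rH rN γ C0 Etau Etau2 P n q cog := by
  obtain ⟨hγ0, hγ1⟩ := hγ
  simp only [tsum_fintype, ← Finset.mul_sum] at hPsum hEtau hMom2
  have hgt : γ ^ tmax < 1 := pow_lt_one₀ hγ0.le hγ1 (by omega)
  have hcoef : ∀ n : ℕ,
      0 ≤ c * (ts : ℝ) * (1 - γ ^ (n * tmax)) / (1 - γ ^ tmax) + C0 * γ ^ (n * tmax) := fun n => by
    have h1 : 0 ≤ 1 - γ ^ (n * tmax) := sub_nonneg.2 (pow_le_one₀ hγ0.le hγ1.le)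
    have h2 : 0 ≤ 1 - γ ^ tmax := sub_nonneg.2 hgt.le
    positivity
  have main : ∀ (n : ℕ) (q : ℤ) (cog : C) (Δ : ℕ),
      (c * (ts : ℝ) * (1 - γ ^ (n * tmax)) / (1 - γ ^ tmax) + C0 * γ ^ (n * tmax)) * (Δ : ℝ)
        ≤ Vn cogStar c lam rH rN γ C0 Etau Etau2 P n q cog
          - Vn cogStar c lam rH rN γ C0 Etau Etau2 P n (q + (Δ : ℤ)) cog := by
    intro n
    induction n with
    | zero =>
      intro q cog Δ
      simp only [Vn, zero_mul, pow_zero]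
      push_cast
      apply le_of_eq
      ring
    | succ n ih =>
      intro q cog Δ
      obtain ⟨K, hK, hV⟩ := exists_linGrowth_Vn (c := c) (rH := rH) (rN := rN) (C0 := C0)
        (Etau := Etau) (Etau2 := Etau2) cogStar hlam.le hγ0.le hγ1.le hPnn hP0 hMom2 n
      obtain ⟨a, ha, hmax⟩ := Finset.exists_mem_eq_sup' (Act_nonempty cogStar cog) fun a =>
        Qval c lam rH rN γ Etau Etau2 P (Vn cogStar c lam rH rN γ C0 Etau Etau2 P n)
          (q + (Δ : ℤ)) cog a
      have hQ := le_Qval_sub (c := c) (rH := rH) (rN := rN) (Etau := Etau) (Etau2 := Etau2)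
        hlam.le hγ0 hγ1.le hK hV cog a (hPnn cog a) (hP0 cog a) (hPsum cog a ha) (hMom2 cog a)
        (hEtau cog a ▸ hEle cog a ha) (mul_nonneg (hcoef n) Δ.cast_nonneg)
        (fun q cog => ih q cog Δ) q
      have hsup := Finset.le_sup' (fun a => Qval c lam rH rN γ Etau Etau2 P
        (Vn cogStar c lam rH rN γ C0 Etau Etau2 P n) q cog a) ha
      have hE : c * (ts : ℝ) * Δ ≤ c * Etau cog a * Δ := by
        have := hEts cog a ha
        gcongr
      have hrec : c * (ts : ℝ) * (1 - γ ^ ((n + 1) * tmax)) / (1 - γ ^ tmax)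
            + C0 * γ ^ ((n + 1) * tmax) =
          c * ts + γ ^ tmax *
            (c * (ts : ℝ) * (1 - γ ^ (n * tmax)) / (1 - γ ^ tmax) + C0 * γ ^ (n * tmax)) := by
        have : 1 - γ ^ tmax ≠ 0 := (sub_pos.2 hgt).ne'
        rw [Nat.succ_mul, pow_add]
        field_simp
        ring
      rw [hrec, Vn, Vn, hmax]
      push_cast at hQ
      linarith
  refine ⟨fun n cog q Δ => ⟨main n q cog Δ, mul_nonneg (hcoef n) Δ.cast_nonneg⟩,
    fun n cog q q' hqq => ?_⟩
  obtain ⟨Δ, rfl⟩ := Int.le.dest hqq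
  exact sub_nonneg.1 ((mul_nonneg (hcoef n) Δ.cast_nonneg).trans (main n q cog Δ))

end Fidelity
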